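/- arXiv:2502.12288 — 3 statements merged into one kernel-verified Lean document; each statement's English description precedes it below -/
import Mathlib

section
/- Let φ, L⁻, L⁺, r, d ∈ ℝ with r ≠ −1, define F₁(t) = sin(πt + φ)/π and F₂(t) = −cos(πt + φ)/π², and let t_{k−1}, t_k, t_{k+1} ∈ ℝ with t_{k+1} = t_{k−1} + 2, Δt_{k−1} = t_k − t_{k−1}, Δt_k = t_{k+1} − t_k, and r·Δt_{k−1} ≠ Δt_k. Suppose Ż_{k−1}, Ż_k ∈ ℝ satisfy the four equations: (i) Ż_k = −r·Ż_{k−1} + F₁(t_k) − F₁(t_{k−1}) − L⁻·Δt_{k−1}; (ii) −d = −r·Ż_{k−1}·Δt_{k−1} + F₂(t_k) − F₂(t_{k−1}) − F₁(t_{k−1})·Δt_{k−1} − L⁻·Δt_{k−1}²/2; (iii) Ż_{k−1} = −r·Ż_k + F₁(t_{k+1}) − F₁(t_k) − L⁺·Δt_k; (iv) d = −r·Ż_k·Δt_k + F₂(t_{k+1}) − F₂(t_k) − F₁(t_k)·Δt_k − L⁺·Δt_k²/2. Then Ż_{k−1} = (−2·F₁(t_{k−1}) − L⁻·Δt_{k−1}²/2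 + L⁺·Δt_k²/2)/(r·Δt_{k−1} − Δt_k). -/
open Real

/-- Expression for the initial impact velocity `Ż_{k-1}` of a 1:1 periodic
solution in terms of the impact times. -/
theorem initial_velocity_formula
    (φ Lm Lp r d : ℝ) (hr : r ≠ -1)
    (tkm tk tkp : ℝ) (hT : tkp = tkm + 2)
    (hden : r * (tk - tkm) ≠ tkp - tk)
    (F1 F2 : ℝ → ℝ)
    (hF1 : ∀ t, F1 t = Real.sin (π * t + φ) / π)
    (hF2 : ∀ t, F2 t = -Real.cos (π * t + φ) / π ^ 2)
    (Zkm Zk : ℝ)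
    (h1 : Zk = -r * Zkm + F1 tk - F1 tkm - Lm * (tk - tkm))
    (h2 : -d = -r * Zkm * (tk - tkm) + F2 tk - F2 tkm - F1 tkm * (tk - tkm)
      - Lm * (tk - tkm) ^ 2 / 2)
    (h3 : Zkm = -r * Zk + F1 tkp - F1 tk - Lp * (tkp - tk))
    (h4 : d = -r * Zk * (tkp - tk) + F2 tkp - F2 tk - F1 tk * (tkp - tk)
      - Lp * (tkp - tk) ^ 2 / 2) :
    Zkm = (-2 * F1 tkm - Lm * (tk - tkm) ^ 2 / 2 + Lp * (tkp - tk) ^ 2 / 2) /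
      (r * (tk - tkm) - (tkp - tk)) := by
  have phase_shift : π * tkp + φ = π * tkm + φ + 2 * π := by rw [hT]; ring
  have hF1_periodic : F1 tkp = F1 tkm := by
    rw [hF1, hF1, phase_shift, Real.sin_add_two_pi]
  have hF2_periodic : F2 tkp = F2 tkm := by
    rw [hF2, hF2, phase_shift, Real.cos_add_two_pi]
  rw [eq_div_iff (sub_ne_zero.mpr hden)]
  subst hT
  linear_combination h2 + h4 - (tkm + 2 - tk) * h3 + hF2_periodic
    - (tkm + 2 - tk) * hF1_periodic
end

section
/- Let φ, L⁻, L⁺, r, d ∈ ℝ with r ≠ −1, define F₁(t) = sin(πt + φ)/π and F₂(t) = −cos(πt + φ)/π², and let t_{k−1}, t_k, t_{k+1} ∈ ℝ with t_{k+1} = t_{k−1} + 2, Δt_{k−1} = t_k − t_{k−1}, Δt_k = t_{k+1} − t_k, and r·Δt_{k−1} ≠ Δt_k. Suppose Ż_{k−1}, Ż_k ∈ ℝ satisfy the four equations: (i) Ż_k = −r·Ż_{k−1} + F₁(t_k) − F₁(t_{k−1}) − L⁻·Δt_{k−1}; (ii) −d = −r·Ż_{k−1}·Δt_{k−1} + F₂(t_k)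 − F₂(t_{k−1}) − F₁(t_{k−1})·Δt_{k−1} − L⁻·Δt_{k−1}²/2; (iii) Ż_{k−1} = −r·Ż_k + F₁(t_{k+1}) − F₁(t_k) − L⁺·Δt_k; (iv) d = −r·Ż_k·Δt_k + F₂(t_{k+1}) − F₂(t_k) − F₁(t_k)·Δt_k − L⁺·Δt_k²/2. Then F₂(t_k) − F₂(t_{k−1}) = −d + (Δt_{k−1}·Δt_k/4)·(L⁺·Δt_k + L⁻·Δt_{k−1} + 2·(1 + r)·Ż_{k−1}). -/
open Real

/-- Expression for the difference `F₂(t_k) - F₂(t_{k-1})` for a 1:1 periodic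
solution. -/
theorem F2_difference_formula
    (φ Lm Lp r d : ℝ) (hr : r ≠ -1)
    (tkm tk tkp : ℝ) (hT : tkp = tkm + 2)
    (hden : r * (tk - tkm) ≠ tkp - tk)
    (F1 F2 : ℝ → ℝ)
    (hF1 : ∀ t, F1 t = Real.sin (π * t + φ) / π)
    (hF2 : ∀ t, F2 t = -Real.cos (π * t + φ) / π ^ 2)
    (Zkm Zk : ℝ)
    (h1 : Zk = -r * Zkm + F1 tk - F1 tkm - Lm * (tk - tkm))
    (h2 : -d = -r * Zkm * (tk - tkm) + F2 tk - F2 tkm - F1 tkm * (tk - tkm)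
      - Lm * (tk - tkm) ^ 2 / 2)
    (h3 : Zkm = -r * Zk + F1 tkp - F1 tk - Lp * (tkp - tk))
    (h4 : d = -r * Zk * (tkp - tk) + F2 tkp - F2 tk - F1 tk * (tkp - tk)
      - Lp * (tkp - tk) ^ 2 / 2) :
    F2 tk - F2 tkm = -d + ((tk - tkm) * (tkp - tk) / 4) *
      (Lp * (tkp - tk) + Lm * (tk - tkm) + 2 * (1 + r) * Zkm) := by
  have hper : π * (tkm + 2) + φ = π * tkm + φ + 2 * π := by ring
  have hF1per : F1 (tkm + 2) = F1 tkm := by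
    rw [hF1, hF1, hper, Real.sin_add_two_pi]
  have hF2per : F2 (tkm + 2) = F2 tkm := by
    rw [hF2, hF2, hper, Real.cos_add_two_pi]
  subst hT
  rw [hF1per] at h3
  rw [hF2per] at h4
  linear_combination (-(tkm + 2 - tk) / 2) * h2 + ((tk - tkm) / 2) * h4
    - ((tk - tkm) * (tkm + 2 - tk) / 2) * h3
end

section
/- Let φ, L, r, d, t₀ ∈ ℝ, define F₁(t) = sin(πt + φ)/π and F₂(t) = −cos(πt + φ)/π², let v₀ ∈ ℝ, and let τ : ℝ → ℝ be differentiable at v₀ such that for all v in some neighborhood of v₀, −r·v + F₁(τ(v)) − F₁(t₀) − L·(τ(v) − t₀) = 0. Define ζ : ℝ → ℝ by ζ(v) = d/2 − r·v·(τ(v) − t₀) + F₂(τ(v)) − F₂(t₀) − F₁(t₀)·(τ(v) − t₀) − (L/2)·(τ(v) − t₀)². Then ζ is differentiable at v₀ and its derivative at v₀ equals −r·(τ(v₀) − t₀). -/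
open Real

/-- The second antiderivative of the forcing differentiates to the first one. -/
theorem hasDerivAt_neg_cos_div_pi_sq (φ t : ℝ) :
    HasDerivAt (fun s => -Real.cos (π * s + φ) / π ^ 2) (Real.sin (π * t + φ) / π) t := by
  have hlin : HasDerivAt (fun s : ℝ => π * s + φ) π t := by
    simpa using ((hasDerivAt_id t).const_mul π).add_const φ
  refine (hlin.cos.neg.div_const (π ^ 2)).congr_deriv ?_
  field_simp

/-- Jacobian entry `∂Z¹/∂Ż_{k-1} = -r Δt⁰`: the displacement at the moment of
reaching `Σ` has derivative `-r (τ(v₀) - t₀)` with respect to the previous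
impact velocity. -/
theorem jacobian_displacement_wrt_velocity
    (φ L r d t0 v0 : ℝ)
    (F1 F2 : ℝ → ℝ)
    (hF1 : ∀ t, F1 t = Real.sin (π * t + φ) / π)
    (hF2 : ∀ t, F2 t = -Real.cos (π * t + φ) / π ^ 2)
    (τ : ℝ → ℝ) (hτ : DifferentiableAt ℝ τ v0)
    (h : ∀ᶠ v in nhds v0, -r * v + F1 (τ v) - F1 t0 - L * (τ v - t0) = 0)
    (ζ : ℝ → ℝ)
    (hζ : ∀ v, ζ v = d / 2 - r * v * (τ v - t0) + F2 (τ v) - F2 t0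
      - F1 t0 * (τ v - t0) - (L / 2) * (τ v - t0) ^ 2) :
    HasDerivAt ζ (-r * (τ v0 - t0)) v0 := by
  have hF2' : HasDerivAt F2 (F1 (τ v0)) (τ v0) := by
    rw [hF1, funext hF2]
    exact hasDerivAt_neg_cos_div_pi_sq φ (τ v0)
  have hdiff : HasDerivAt (fun v => τ v - t0) (deriv τ v0) v0 := hτ.hasDerivAt.sub_const t0
  have hvel : HasDerivAt (fun v : ℝ => r * v) r v0 := by
    simpa using (hasDerivAt_id v0).const_mul r
  rw [funext hζ]
  refine (((((hvel.mul hdiff).const_sub (d / 2)).add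
    (hF2'.comp v0 hτ.hasDerivAt)).sub_const (F2 t0)).sub
    (hdiff.const_mul (F1 t0)) |>.sub ((hdiff.pow 2).const_mul (L / 2))).congr_deriv ?_
  norm_num
  linear_combination deriv τ v0 * h.self_of_nhds
end
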